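/- Let 0 < ν < 1 and κ ∈ ℝ. Then ∫_0^∞ cos(κx) · M_ν(x) dx = E_{2ν}(-κ²); equivalently, the Fourier transform of the symmetric probability density (1/2)·M_ν(|x|) on ℝ equals E_{2ν}(-κ²). -/

import Mathlib

/-- The Wright function `W_{λ,μ}(x) = ∑ xⁿ/(n!·Γ(λn+μ))` for real parameters and
real argument, with the convention `1/Γ(w) = 0` at poles of `Γ`. -/
noncomputable def wright (l μ x : ℝ) : ℝ :=
  ∑' n : ℕ, x ^ n / ((n.factorial : ℝ) * Real.Gamma (l * n + μ))

/-- The Mainardi function `M_ν(x) := W_{-ν,1-ν}(-x)`. -/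
noncomputable def mainardiM (ν x : ℝ) : ℝ := wright (-ν) (1 - ν) (-x)

/-- The Mittag-Leffler function `E_{α,β}(x) = ∑ xⁿ/Γ(αn+β)`. -/
noncomputable def mittagLeffler (α β x : ℝ) : ℝ :=
  ∑' n : ℕ, x ^ n / Real.Gamma (α * n + β)

open Real Set Filter Topology MeasureTheory

/-- Laplace transform of `r ^ (p - 1)` at a complex parameter in the right half-plane. -/
theorem integral_rpow_mul_cexp_neg_mul {p : ℝ} (hp : 0 < p) {w : ℂ} (hw : 0 < w.re) :
    ∫ r in Ioi (0 : ℝ), ((r ^ (p - 1) : ℝ) : ℂ) * Complex.exp (-w * r) =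
      w ^ (-p : ℂ) * (Real.Gamma p : ℂ) := by
  have hint : ∀ q : ℝ, 0 < q → ∀ b : ℝ, 0 < b →
      IntegrableOn (fun r : ℝ => r ^ (q - 1) * rexp (-b * r)) (Ioi 0) := by
    intro q hq b hb
    have := integrableOn_rpow_mul_exp_neg_mul_rpow (p := 1) (s := q - 1) (by linarith) one_pos hb
    simpa using this
  have hmeas : ∀ (q : ℝ) (w : ℂ), AEStronglyMeasurable
      (fun r : ℝ => ((r ^ q : ℝ) : ℂ) * Complex.exp (-w * r)) (volume.restrict (Ioi 0)) := by
    intro q w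
    apply Measurable.aestronglyMeasurable
    fun_prop
  have hnorm : ∀ (q : ℝ) (w : ℂ) (r : ℝ), 0 < r →
      ‖((r ^ q : ℝ) : ℂ) * Complex.exp (-w * r)‖ = r ^ q * rexp (-w.re * r) := by
    intro q w r hr
    rw [norm_mul, Complex.norm_exp, Complex.norm_real, Real.norm_of_nonneg (by positivity)]
    simp
  set U : Set ℂ := {w | 0 < w.re}
  have hU : IsOpen U := isOpen_lt continuous_const Complex.continuous_re
  have hUc : IsPreconnected U := (convex_halfSpace_re_gt 0).isPreconnected
  have hdiff : DifferentiableOn ℂ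
      (fun w : ℂ => ∫ r in Ioi (0 : ℝ), ((r ^ (p - 1) : ℝ) : ℂ) * Complex.exp (-w * r)) U := by
    intro w hw
    have hw : 0 < w.re := hw
    refine ((hasDerivAt_integral_of_dominated_loc_of_deriv_le
      (F' := fun w r => -(((r ^ p : ℝ) : ℂ) * Complex.exp (-w * r)))
      (s := {z : ℂ | w.re / 2 < z.re}) (bound := fun r => r ^ (p + 1 - 1) * rexp (-(w.re / 2) * r))
      ?_ ?_ ?_ ?_ ?_ ?_ ?_).2.differentiableAt).differentiableWithinAt
    · exact (isOpen_lt continuous_const Complex.continuous_re).mem_nhds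
        (show w.re / 2 < w.re by linarith)
    · exact Eventually.of_forall fun z => hmeas _ z
    · refine (hint p hp _ hw).mono' (hmeas _ _) ?_
      filter_upwards [ae_restrict_mem measurableSet_Ioi] with r hr
      exact (hnorm _ _ r hr).le
    · exact (hmeas _ _).neg
    · filter_upwards [ae_restrict_mem measurableSet_Ioi] with r hr z hz
      have hr : 0 < r := hr
      have hz : w.re / 2 < z.re := hz
      rw [norm_neg, hnorm _ _ r hr, add_sub_cancel_right]
      gcongr
    · exact hint (p + 1) (by linarith) _ (by linarith)
    · filter_upwards [ae_restrict_mem measurableSet_Ioi] with r hr z hz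
      have hr : 0 < r := hr
      have h1 : HasDerivAt (fun z : ℂ => Complex.exp (-z * r))
          (Complex.exp (-z * r) * (-1 * r)) z :=
        (((hasDerivAt_id z).neg).mul_const (r : ℂ)).cexp
      convert! h1.const_mul ((r ^ (p - 1) : ℝ) : ℂ) using 1
      have : r ^ p = r ^ (p - 1) * r := by
        rw [← Real.rpow_add_one hr.ne']; ring_nf
      rw [this]; push_cast; ring
  have hdiff' : DifferentiableOn ℂ (fun w : ℂ => w ^ (-p : ℂ) * (Real.Gamma p : ℂ)) U := by
    intro w hw
    exact ((differentiableAt_id.cpow_const (Or.inl hw)).mul_const _).differentiableWithinAt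
  refine (hdiff.analyticOnNhd hU).eqOn_of_preconnected_of_frequently_eq
    (hdiff'.analyticOnNhd hU) hUc (z₀ := 1) (by simp [U]) ?_ hw
  have hreal : ∀ b : ℝ, 0 < b →
      ∫ r in Ioi (0 : ℝ), ((r ^ (p - 1) : ℝ) : ℂ) * Complex.exp (-(b : ℂ) * r) =
        (b : ℂ) ^ (-p : ℂ) * (Real.Gamma p : ℂ) := by
    intro b hb
    have h := Real.integral_rpow_mul_exp_neg_mul_Ioi hp hb
    have h2 : ∀ r : ℝ, ((r ^ (p - 1) : ℝ) : ℂ) * Complex.exp (-(b : ℂ) * r) =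
        ((r ^ (p - 1) * rexp (-(b * r)) : ℝ) : ℂ) := by
      intro r; push_cast; ring_nf
    simp_rw [h2]
    rw [integral_complex_ofReal, h, ← Complex.ofReal_neg, ← Complex.ofReal_cpow hb.le,
      one_div, Real.inv_rpow hb.le, Real.rpow_neg hb.le]
    push_cast; ring
  have ht : Tendsto (fun b : ℝ => (b : ℂ)) (𝓝[>] 1) (𝓝[≠] 1) := by
    refine tendsto_nhdsWithin_iff.2 ⟨?_, ?_⟩
    · exact (Complex.continuous_ofReal.tendsto' 1 1 (by simp)).mono_left nhdsWithin_le_nhds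
    · filter_upwards [self_mem_nhdsWithin] with b hb
      simpa using (ne_of_gt hb)
  refine ht.frequently (Eventually.frequently ?_)
  filter_upwards [self_mem_nhdsWithin] with b hb
  exact hreal b (by linarith [show (1:ℝ) < b from hb])

/-- The ray issuing from `c` with direction `exp (i φ)`. -/
noncomputable def hankelRay (φ c r : ℝ) : ℂ := c + r * Complex.exp (φ * Complex.I)

theorem hankelRay_re (φ c r : ℝ) : (hankelRay φ c r).re = c + r * cos φ := by
  simp [hankelRay, Complex.exp_ofReal_mul_I_re]

theorem hankelRay_im (φ c r : ℝ) : (hankelRay φ c r).im = r * sin φ := by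
  simp [hankelRay, Complex.exp_ofReal_mul_I_im]

theorem continuous_hankelRay (φ c : ℝ) : Continuous (hankelRay φ c) := by
  unfold hankelRay; fun_prop

theorem hasDerivAt_hankelRay (φ c r : ℝ) :
    HasDerivAt (hankelRay φ c) (Complex.exp (φ * Complex.I)) r := by
  unfold hankelRay
  simpa using ((Complex.ofRealCLM.hasDerivAt (x := r)).mul_const
    (Complex.exp (φ * Complex.I))).const_add (c : ℂ)

theorem hasDerivAt_hankelRay_left (φ c r : ℝ) :
    HasDerivAt (fun c => hankelRay φ c r) 1 c := by
  unfold hankelRay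
  simpa using (Complex.ofRealCLM.hasDerivAt (x := c)).add_const (r * Complex.exp (φ * Complex.I))

theorem norm_hankelRay_le {φ c r : ℝ} (hc : 0 ≤ c) (hr : 0 ≤ r) : ‖hankelRay φ c r‖ ≤ c + r := by
  refine (norm_add_le _ _).trans ?_
  simp [Complex.norm_exp_ofReal_mul_I, abs_of_nonneg hc, abs_of_nonneg hr]

theorem le_norm_hankelRay_left {φ c r : ℝ} : c * sin φ ≤ ‖hankelRay φ c r‖ := by
  have h : (hankelRay φ c r * Complex.exp ((-φ : ℝ) * Complex.I)).im = -(c * sin φ) := by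
    rw [Complex.mul_im, hankelRay_re, hankelRay_im, Complex.exp_ofReal_mul_I_im,
      Complex.exp_ofReal_mul_I_re, sin_neg, cos_neg]
    ring
  have h2 := Complex.abs_im_le_norm (hankelRay φ c r * Complex.exp ((-φ : ℝ) * Complex.I))
  rw [h, norm_mul, Complex.norm_exp_ofReal_mul_I, mul_one, abs_neg] at h2
  exact (le_abs_self _).trans h2

theorem le_norm_hankelRay_right {φ c r : ℝ} : r * sin φ ≤ ‖hankelRay φ c r‖ := by
  rw [← hankelRay_im φ c r]
  exact (le_abs_self _).trans (Complex.abs_im_le_norm _)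

theorem hankelRay_mem_slitPlane {φ c r : ℝ} (hφ : 0 < sin φ) (hr : 0 ≤ r)
    (h : 0 < c + r) : hankelRay φ c r ∈ Complex.slitPlane := by
  rw [Complex.mem_slitPlane_iff, hankelRay_re, hankelRay_im]
  rcases hr.eq_or_lt with rfl | hr
  · left; simpa using h
  · right; positivity

theorem arg_hankelRay_mem {φ c r : ℝ} (hφ : φ ∈ Ioo 0 π) (hc : 0 < c) (hr : 0 ≤ r) :
    (hankelRay φ c r).arg ∈ Icc 0 φ := by
  have hs := sin_pos_of_mem_Ioo hφ
  have h0 : 0 ≤ (hankelRay φ c r).arg := by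
    rw [Complex.arg_nonneg_iff, hankelRay_im]; positivity
  refine ⟨h0, ?_⟩
  by_contra! hlt
  have hn : 0 < ‖hankelRay φ c r‖ := (mul_pos hc hs).trans_le le_norm_hankelRay_left
  have h := Complex.norm_mul_sin_arg (hankelRay φ c r)
  have h' := Complex.norm_mul_cos_arg (hankelRay φ c r)
  rw [hankelRay_im] at h
  rw [hankelRay_re] at h'
  have hpos : 0 < sin ((hankelRay φ c r).arg - φ) :=
    sin_pos_of_pos_of_lt_pi (by linarith)
      (by linarith [Complex.arg_le_pi (hankelRay φ c r), hφ.1])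
  rw [sin_sub] at hpos
  have : ‖hankelRay φ c r‖ * (sin (hankelRay φ c r).arg * cos φ
      - cos (hankelRay φ c r).arg * sin φ) = -(c * sin φ) := by
    linear_combination cos φ * h - sin φ * h'
  nlinarith [mul_pos hn hpos, mul_pos hc hs]

/-- The integrand of Hankel's integral along the ray. -/
noncomputable def hankelKernel (φ c z r : ℝ) : ℂ :=
  Complex.exp (φ * Complex.I) * (Complex.exp (hankelRay φ c r) * hankelRay φ c r ^ (-z : ℂ))

theorem norm_hankelKernel (φ c z r : ℝ) :
    ‖hankelKernel φ c z r‖ = rexp (c + r * cos φ) * ‖hankelRay φ c r‖ ^ (-z) := by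
  rw [hankelKernel, norm_mul, norm_mul, Complex.norm_exp_ofReal_mul_I, Complex.norm_exp,
    hankelRay_re, ← Complex.ofReal_neg, Complex.norm_cpow_real, one_mul]

theorem Real.rpow_le_add_inv_rpow {δ u t p P : ℝ} (hδ : 0 < δ) (h1 : δ ≤ t) (h2 : t ≤ u)
    (hp : |p| ≤ P) : t ^ p ≤ (u + δ⁻¹) ^ P := by
  have ht : 0 < t := hδ.trans_le h1
  have hδ' : 0 < δ⁻¹ := inv_pos.2 hδ
  have hB : 1 ≤ u + δ⁻¹ := by
    rcases le_total 1 u with h | h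
    · linarith
    · have : 1 ≤ δ⁻¹ := (one_le_inv₀ hδ).2 (by linarith)
      linarith
  refine le_trans ?_ (Real.rpow_le_rpow_of_exponent_le hB hp)
  rcases le_total 0 p with h | h
  · rw [abs_of_nonneg h]
    exact Real.rpow_le_rpow ht.le (by linarith) h
  · rw [abs_of_nonpos h, ← neg_neg p, Real.rpow_neg ht.le, ← Real.inv_rpow ht.le, neg_neg]
    refine Real.rpow_le_rpow (by positivity) ?_ (by linarith)
    have := inv_anti₀ hδ h1
    linarith

theorem norm_hankelKernel_le {φ c c₁ c₂ z P r : ℝ} (hφ : 0 < sin φ) (hc₁ : 0 < c₁) (h₁ : c₁ ≤ c)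
    (h₂ : c ≤ c₂) (hr : 0 ≤ r) (hz : |z| ≤ P) :
    ‖hankelKernel φ c z r‖ ≤
      rexp c₂ * (rexp (cos φ * r) * (r + (c₂ + (c₁ * sin φ)⁻¹)) ^ P) := by
  rw [norm_hankelKernel, ← mul_assoc, ← Real.exp_add, mul_comm (cos φ)]
  have hδ : 0 < c₁ * sin φ := mul_pos hc₁ hφ
  have := Real.rpow_le_add_inv_rpow (p := -z) (P := P) hδ
    ((mul_le_mul_of_nonneg_right h₁ hφ.le).trans (le_norm_hankelRay_left (r := r)))
    ((norm_hankelRay_le (φ := φ) (by linarith) hr).trans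
      (show c + r ≤ r + c₂ by linarith)) (by rwa [abs_neg])
  rw [← add_assoc]
  gcongr

theorem integrableOn_exp_mul_rpow_mul_exp_rpow {b β P ν x : ℝ} (hb : b < 0) (hβ : 0 < β)
    (hν1 : ν < 1) :
    IntegrableOn (fun r => rexp (b * r) * (r + β) ^ P * rexp (x * (r + β) ^ ν)) (Ioi 0) := by
  refine integrable_of_isBigO_exp_neg (b := -b / 3) (by linarith) ?_ ?_
  · refine ContinuousOn.mul (ContinuousOn.mul (by fun_prop) ?_)
      (Real.continuous_exp.comp_continuousOn (continuousOn_const.mul ?_))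
    all_goals
      refine ContinuousOn.rpow_const (by fun_prop) fun r hr => Or.inl ?_
      have : 0 ≤ r := hr
      positivity
  · have hshift : Tendsto (fun r : ℝ => r + β) atTop atTop :=
      tendsto_atTop_add_const_right _ _ tendsto_id
    have h1 : (fun r : ℝ => (r + β) ^ P) =O[atTop] fun r => rexp (-b / 3 * (r + β)) :=
      ((isLittleO_rpow_exp_pos_mul_atTop P (b := -b / 3) (by linarith)).comp_tendsto hshift).isBigO
    have h2 : (fun r : ℝ => rexp (x * (r + β) ^ ν)) =O[atTop] fun r => rexp (-b / 3 * (r + β)) := by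
      refine Asymptotics.IsBigO.of_bound 1 ?_
      have hk : 0 < -b / 3 / (|x| + 1) := by
        apply div_pos <;> [linarith; positivity]
      have h4 := (tendsto_rpow_neg_atTop (sub_pos.2 hν1)).comp hshift |>.eventually_le_const hk
      filter_upwards [h4, eventually_ge_atTop 0] with r hr hr0
      rw [one_mul, Real.norm_of_nonneg (Real.exp_pos _).le, Real.norm_of_nonneg (Real.exp_pos _).le]
      rw [Real.exp_le_exp]
      have hp : 0 < r + β := by linarith
      have hmul : (r + β) ^ ν = (r + β) ^ (-(1 - ν)) * (r + β) := by
        rw [← Real.rpow_add_one hp.ne']; ring_nf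
      calc x * (r + β) ^ ν ≤ (|x| + 1) * (r + β) ^ ν := by
            gcongr; linarith [le_abs_self x]
        _ ≤ (|x| + 1) * (-b / 3 / (|x| + 1) * (r + β)) := by
            rw [hmul]
            gcongr
            exact hr
        _ = _ := by field_simp
    have h5 := ((Asymptotics.isBigO_refl (fun r => rexp (b * r)) atTop).mul h1).mul h2
    refine h5.trans (Asymptotics.IsBigO.of_bound (rexp (-b / 3 * β) * rexp (-b / 3 * β))
      (Eventually.of_forall fun r => ?_))
    rw [Real.norm_of_nonneg (by positivity), Real.norm_of_nonneg (by positivity)]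
    simp only [← Real.exp_add]
    rw [Real.exp_le_exp]
    linarith

theorem integrableOn_exp_mul_rpow {b β P : ℝ} (hb : b < 0) (hβ : 0 < β) :
    IntegrableOn (fun r => rexp (b * r) * (r + β) ^ P) (Ioi 0) := by
  simpa using integrableOn_exp_mul_rpow_mul_exp_rpow (P := P) (x := 0) (ν := 0) hb hβ one_pos

theorem hankelRay_ne_zero {φ c r : ℝ} (hφ : 0 < sin φ) (hr : 0 ≤ r) (h : 0 < c + r) :
    hankelRay φ c r ≠ 0 :=
  Complex.slitPlane_ne_zero (hankelRay_mem_slitPlane hφ hr h)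

theorem measurable_hankelRay (φ c : ℝ) : Measurable (hankelRay φ c) :=
  (continuous_hankelRay φ c).measurable

theorem measurable_hankelKernel (φ c z : ℝ) : Measurable (hankelKernel φ c z) := by
  have := measurable_hankelRay φ c
  unfold hankelKernel
  fun_prop

theorem integrableOn_hankelKernel {φ c : ℝ} (z : ℝ) (hφ : 0 < sin φ) (hφ' : cos φ < 0)
    (hc : 0 < c) :
    IntegrableOn (hankelKernel φ c z) (Ioi 0) := by
  refine ((integrableOn_exp_mul_rpow (P := |z|) (β := c + (c * sin φ)⁻¹) hφ'
    (by positivity)).const_mul (rexp c)).mono'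
      (measurable_hankelKernel φ c z).aestronglyMeasurable ?_
  filter_upwards [ae_restrict_mem measurableSet_Ioi] with r hr
  exact norm_hankelKernel_le hφ hc le_rfl le_rfl (le_of_lt hr) le_rfl

theorem hasDerivAt_cexp_mul_cpow {z : ℝ} {s : ℂ} (hs : s ∈ Complex.slitPlane) :
    HasDerivAt (fun s : ℂ => Complex.exp s * s ^ (-z : ℂ))
      (Complex.exp s * s ^ (-z : ℂ) - z * (Complex.exp s * s ^ (-(z + 1 : ℝ) : ℂ))) s := by
  convert! (Complex.hasDerivAt_exp s).mul
    ((hasDerivAt_id s).cpow_const (c := (-z : ℂ)) hs) using 1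
  have : (-(z + 1 : ℝ) : ℂ) = -z - 1 := by push_cast; ring
  rw [this]
  simp only [id]
  ring

theorem integral_hankelKernel_sub {φ c : ℝ} (z : ℝ) (hφ : 0 < sin φ) (hφ' : cos φ < 0)
    (hc : 0 < c) :
    (∫ r in Ioi 0, hankelKernel φ c z r) - z * ∫ r in Ioi 0, hankelKernel φ c (z + 1) r =
      ((-(rexp c * c ^ (-z)) : ℝ) : ℂ) := by
  have hderiv : ∀ r ∈ Ici (0 : ℝ), HasDerivAt
      (fun r => Complex.exp (hankelRay φ c r) * hankelRay φ c r ^ (-z : ℂ))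
      (hankelKernel φ c z r - z * hankelKernel φ c (z + 1) r) r := by
    intro r hr
    have hr : 0 ≤ r := hr
    have h := (hasDerivAt_cexp_mul_cpow (z := z)
      (hankelRay_mem_slitPlane hφ hr (by linarith))).comp r (hasDerivAt_hankelRay φ c r)
    convert! h using 1
    simp only [hankelKernel]
    ring
  have hi1 := integrableOn_hankelKernel z hφ hφ' hc
  have hi2 := (integrableOn_hankelKernel (z + 1) hφ hφ' hc).const_mul (z : ℂ)
  have hi0 : IntegrableOn (fun r => Complex.exp (hankelRay φ c r) * hankelRay φ c r ^ (-z : ℂ))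
      (Ioi 0) := by
    refine (hi1.const_mul (Complex.exp (φ * Complex.I))⁻¹).congr
      (Eventually.of_forall fun r => ?_)
    simp [hankelKernel]
  have hlim := tendsto_zero_of_hasDerivAt_of_integrableOn_Ioi
    (fun r hr => hderiv r (Ioi_subset_Ici_self hr)) (hi1.sub hi2) hi0
  have h := integral_Ioi_of_hasDerivAt_of_tendsto' hderiv (hi1.sub hi2) hlim
  rw [integral_sub hi1 hi2, integral_const_mul] at h
  rw [h]
  simp only [hankelRay]
  push_cast
  rw [Complex.ofReal_cpow hc.le]
  simp

theorem im_integral_hankelKernel_add_one {φ c : ℝ} (z : ℝ) (hφ : 0 < sin φ) (hφ' : cos φ < 0)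
    (hc : 0 < c) :
    (∫ r in Ioi 0, hankelKernel φ c z r).im =
      z * (∫ r in Ioi 0, hankelKernel φ c (z + 1) r).im := by
  have h := congrArg Complex.im (integral_hankelKernel_sub z hφ hφ' hc)
  rw [Complex.sub_im, Complex.im_ofReal_mul, Complex.ofReal_im] at h
  linarith

theorem hasDerivAt_integral_hankelKernel {φ c : ℝ} (z : ℝ) (hφ : 0 < sin φ) (hφ' : cos φ < 0)
    (hc : 0 < c) :
    HasDerivAt (fun c => ∫ r in Ioi 0, hankelKernel φ c z r)
      ((-(rexp c * c ^ (-z)) : ℝ) : ℂ) c := by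
  rw [← integral_hankelKernel_sub z hφ hφ' hc, ← integral_const_mul,
    ← integral_sub (integrableOn_hankelKernel z hφ hφ' hc)
      ((integrableOn_hankelKernel (z + 1) hφ hφ' hc).const_mul _)]
  have hb : ∀ P : ℝ, IntegrableOn (fun r => rexp (2 * c) * (rexp (cos φ * r) *
      (r + (2 * c + (c / 2 * sin φ)⁻¹)) ^ P)) (Ioi 0) := fun P =>
    (integrableOn_exp_mul_rpow (P := P) hφ' (by positivity)).const_mul _
  refine (hasDerivAt_integral_of_dominated_loc_of_deriv_le (s := Ioo (c / 2) (2 * c))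
    (F' := fun c r => hankelKernel φ c z r - z * hankelKernel φ c (z + 1) r)
    (Ioo_mem_nhds (by linarith) (by linarith))
    (Eventually.of_forall fun c => (measurable_hankelKernel φ c z).aestronglyMeasurable)
    (integrableOn_hankelKernel z hφ hφ' hc)
    ((measurable_hankelKernel φ c z).sub
      ((measurable_hankelKernel φ c (z + 1)).const_mul _)).aestronglyMeasurable
    ?_ ((hb |z|).add ((hb |z + 1|).const_mul |z|)) ?_).2
  · filter_upwards [ae_restrict_mem measurableSet_Ioi] with r hr c' hc'
    refine (norm_sub_le _ _).trans (add_le_add ?_ ?_)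
    · exact norm_hankelKernel_le hφ (by linarith) hc'.1.le hc'.2.le (le_of_lt hr) le_rfl
    · rw [norm_mul, Complex.norm_real, Real.norm_eq_abs]
      refine mul_le_mul_of_nonneg_left ?_ (abs_nonneg z)
      exact norm_hankelKernel_le hφ (by linarith) hc'.1.le hc'.2.le (le_of_lt hr) le_rfl
  · filter_upwards [ae_restrict_mem measurableSet_Ioi] with r hr c' hc'
    have hr : 0 < r := hr
    have h := ((hasDerivAt_cexp_mul_cpow (z := z) (hankelRay_mem_slitPlane (c := c') hφ hr.le
      (by linarith [hc'.1]))).comp c' (hasDerivAt_hankelRay_left φ c' r)).const_mul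
        (Complex.exp (φ * Complex.I))
    convert! h using 1
    simp only [hankelKernel]
    ring

theorem continuousOn_integral_hankelKernel {φ C z : ℝ} (hφ : 0 < sin φ) (hφ' : cos φ < 0)
    (hz0 : 0 < z) (hz1 : z < 1) :
    ContinuousOn (fun c => ∫ r in Ioi 0, hankelKernel φ c z r) (Icc 0 C) := by
  have hint : IntegrableOn
      (fun r : ℝ => rexp C * (sin φ) ^ (-z) * (r ^ (-z) * rexp (-(-cos φ) * r))) (Ioi 0) := by
    have := integrableOn_rpow_mul_exp_neg_mul_rpow (p := 1) (s := -z) (b := -cos φ)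
      (by linarith) one_pos (by linarith)
    exact Integrable.const_mul (by simpa [IntegrableOn] using this) _
  refine continuousOn_of_dominated
    (fun c _ => (measurable_hankelKernel φ c z).aestronglyMeasurable) (fun c hc => ?_) hint ?_
  · filter_upwards [ae_restrict_mem measurableSet_Ioi] with r hr
    have hr : 0 < r := hr
    have h1 : ‖hankelRay φ c r‖ ^ (-z) ≤ (r * sin φ) ^ (-z) :=
      Real.rpow_le_rpow_of_nonpos (by positivity) le_norm_hankelRay_right (by linarith)
    rw [norm_hankelKernel, Real.exp_add]
    rw [Real.mul_rpow hr.le hφ.le] at h1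
    calc _ ≤ rexp C * rexp (r * cos φ) * (r ^ (-z) * sin φ ^ (-z)) := by
          gcongr; exact hc.2
      _ = _ := by rw [neg_neg, mul_comm r (cos φ)]; ring
  · filter_upwards [ae_restrict_mem measurableSet_Ioi] with r hr c hc
    have hr : 0 < r := hr
    have h := ((hasDerivAt_cexp_mul_cpow (z := z) (hankelRay_mem_slitPlane (c := c) hφ hr.le
      (by linarith [hc.1]))).comp c (hasDerivAt_hankelRay_left φ c r)).const_mul
        (Complex.exp (φ * Complex.I))
    exact h.continuousAt.continuousWithinAt

theorem im_integral_hankelKernel_zero {φ z : ℝ} (hφ : φ ∈ Ioo (π / 2) π)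
    (hz0 : 0 < z) (hz1 : z < 1) :
    (∫ r in Ioi 0, hankelKernel φ 0 z r).im = π * (Real.Gamma z)⁻¹ := by
  have hφ' : cos φ < 0 := cos_neg_of_pi_div_two_lt_of_lt hφ.1 (by linarith [hφ.2, pi_pos])
  set e := Complex.exp (φ * Complex.I) with he
  have he0 : e ≠ 0 := Complex.exp_ne_zero _
  have hpt : ∀ r ∈ Ioi (0 : ℝ), hankelKernel φ 0 z r = e ^ (1 - z : ℂ) *
      (((r ^ ((1 - z) - 1) : ℝ) : ℂ) * Complex.exp (-(-e) * r)) := by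
    intro r hr
    have hr : 0 < r := hr
    have h1 : hankelRay φ 0 r = r * e := by simp [hankelRay, he]
    have h2 : ((r : ℂ) * e) ^ (-z : ℂ) = (r : ℂ) ^ (-z : ℂ) * e ^ (-z : ℂ) := by
      rw [Complex.cpow_def_of_ne_zero (mul_ne_zero (by exact_mod_cast hr.ne') he0),
        Complex.cpow_def_of_ne_zero (by exact_mod_cast hr.ne'), Complex.cpow_def_of_ne_zero he0,
        Complex.log_ofReal_mul hr he0, ← Complex.exp_add, ← add_mul, Complex.ofReal_log hr.le]
    rw [hankelKernel, h1, h2, neg_neg, mul_comm e (r : ℂ), sub_sub_cancel_left,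
      Complex.ofReal_cpow hr.le, sub_eq_add_neg, Complex.cpow_add _ _ he0, Complex.cpow_one]
    push_cast
    ring
  have hlog : Complex.log e = φ * Complex.I :=
    Complex.log_exp (by simp; linarith [hφ.1, pi_pos]) (by simpa using hφ.2.le)
  have hlog' : Complex.log (-e) = ((φ - π : ℝ) : ℂ) * Complex.I := by
    have : -e = Complex.exp (((φ - π : ℝ) : ℂ) * Complex.I) := by
      push_cast
      rw [sub_mul, Complex.exp_sub, Complex.exp_pi_mul_I, he, div_neg, div_one]
    rw [this]
    exact Complex.log_exp (by rw [Complex.mul_I_im, Complex.ofReal_re]; linarith [hφ.1, pi_pos])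
      (by rw [Complex.mul_I_im, Complex.ofReal_re]; linarith [hφ.2, pi_pos])
  have hre : 0 < (-e).re := by
    rw [he, Complex.neg_re, Complex.exp_ofReal_mul_I_re]; linarith
  rw [setIntegral_congr_fun measurableSet_Ioi hpt, integral_const_mul,
    integral_rpow_mul_cexp_neg_mul (by linarith) hre, ← mul_assoc,
    Complex.cpow_def_of_ne_zero he0, Complex.cpow_def_of_ne_zero (neg_ne_zero.2 he0), hlog, hlog',
    ← Complex.exp_add]
  have harg : (φ * Complex.I * (1 - z) + ((φ - π : ℝ) : ℂ) * Complex.I * (-((1 - z : ℝ) : ℂ))) =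
      ((π * (1 - z) : ℝ) : ℂ) * Complex.I := by
    push_cast; ring
  have hrefl := Real.Gamma_mul_Gamma_one_sub z
  have hs : 0 < sin (π * z) := sin_pos_of_pos_of_lt_pi (by positivity) (by nlinarith [pi_pos])
  have hG := (Real.Gamma_pos_of_pos hz0).ne'
  rw [harg, Complex.im_mul_ofReal, Complex.exp_ofReal_mul_I_im,
    show π * (1 - z) = π - π * z by ring, sin_pi_sub]
  rw [eq_div_iff hs.ne'] at hrefl
  rw [eq_mul_inv_iff_mul_eq₀ hG]
  linarith

theorem im_integral_hankelKernel_of_mem_Ioo {φ c z : ℝ} (hφ : φ ∈ Ioo (π / 2) π) (hc : 0 < c)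
    (hz0 : 0 < z) (hz1 : z < 1) :
    (∫ r in Ioi 0, hankelKernel φ c z r).im = π * (Real.Gamma z)⁻¹ := by
  have hs : 0 < sin φ := sin_pos_of_pos_of_lt_pi (by linarith [hφ.1, pi_pos]) hφ.2
  have hφ' : cos φ < 0 := cos_neg_of_pi_div_two_lt_of_lt hφ.1 (by linarith [hφ.2, pi_pos])
  obtain ⟨x, -, hx⟩ := exists_hasDerivAt_eq_slope
    (fun c => (∫ r in Ioi 0, hankelKernel φ c z r).im) (fun _ => 0) hc
    (Complex.continuous_im.comp_continuousOn (continuousOn_integral_hankelKernel hs hφ' hz0 hz1))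
    (fun x hx => by
      have h := Complex.imCLM.hasFDerivAt.comp_hasDerivAt x
        (hasDerivAt_integral_hankelKernel z hs hφ' hx.1)
      simpa [Function.comp_def] using h)
  rw [eq_comm, div_eq_zero_iff, or_iff_left (by linarith), sub_eq_zero] at hx
  rw [← im_integral_hankelKernel_zero hφ hz0 hz1]
  exact hx

theorem continuousAt_integral_hankelKernel {φ c : ℝ} (z : ℝ) (hφ : 0 < sin φ) (hφ' : cos φ < 0)
    (hc : 0 < c) : ContinuousAt (fun z => ∫ r in Ioi 0, hankelKernel φ c z r) z := by
  refine continuousAt_of_dominated (Eventually.of_forall fun z =>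
    (measurable_hankelKernel φ c z).aestronglyMeasurable) ?_
    ((integrableOn_exp_mul_rpow (P := |z| + 1) (β := c + (c * sin φ)⁻¹) hφ'
    (by positivity)).const_mul (rexp c)) ?_
  · filter_upwards [continuous_abs.continuousAt.eventually_le_const
      (show |z| < |z| + 1 by linarith)] with y hy
    filter_upwards [ae_restrict_mem measurableSet_Ioi] with r hr
    exact norm_hankelKernel_le hφ hc le_rfl le_rfl (le_of_lt hr) hy
  · filter_upwards [ae_restrict_mem measurableSet_Ioi] with r hr
    have h0 := hankelRay_ne_zero (c := c) hφ (le_of_lt hr) (by linarith [show 0 < r from hr])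
    have : Continuous fun y : ℝ => hankelRay φ c r ^ (-y : ℂ) :=
      Continuous.const_cpow (by fun_prop) (Or.inl h0)
    exact (continuous_const.mul (continuous_const.mul this)).continuousAt

/-- Hankel's formula for the reciprocal Gamma function. -/
theorem im_integral_hankelKernel {φ c : ℝ} (z : ℝ) (hφ : φ ∈ Ioo (π / 2) π) (hc : 0 < c) :
    (∫ r in Ioi 0, hankelKernel φ c z r).im = π * (Real.Gamma z)⁻¹ := by
  have hs : 0 < sin φ := sin_pos_of_pos_of_lt_pi (by linarith [hφ.1, pi_pos]) hφ.2
  have hφ' : cos φ < 0 := cos_neg_of_pi_div_two_lt_of_lt hφ.1 (by linarith [hφ.2, pi_pos])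
  have hrec : ∀ z : ℝ, (Real.Gamma z)⁻¹ = z * (Real.Gamma (z + 1))⁻¹ := by
    intro z
    rcases eq_or_ne z 0 with rfl | hz
    · simp
    · rw [Real.Gamma_add_one hz, mul_inv, mul_inv_cancel_left₀ hz]
  have hbase : ∀ z ∈ Ioc (0 : ℝ) 1,
      (∫ r in Ioi 0, hankelKernel φ c z r).im = π * (Real.Gamma z)⁻¹ := by
    rintro z ⟨hz0, hz1⟩
    rcases hz1.lt_or_eq with h | rfl
    · exact im_integral_hankelKernel_of_mem_Ioo hφ hc hz0 h
    have h1 : Tendsto (fun z => (∫ r in Ioi 0, hankelKernel φ c z r).im) (𝓝[<] 1)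
        (𝓝 (∫ r in Ioi 0, hankelKernel φ c 1 r).im) :=
      ((Complex.continuous_im.continuousAt.comp
        (continuousAt_integral_hankelKernel 1 hs hφ' hc)).tendsto).mono_left nhdsWithin_le_nhds
    have h2 : Tendsto (fun z : ℝ => π * (Real.Gamma z)⁻¹) (𝓝[<] 1) (𝓝 (π * (Real.Gamma 1)⁻¹)) := by
      have hd : DifferentiableAt ℝ Real.Gamma 1 :=
        Real.differentiableAt_Gamma fun m => by
          have : (0 : ℝ) ≤ m := m.cast_nonneg
          linarith
      exact ((hd.continuousAt.inv₀ (by simp)).tendsto.const_mul π).mono_left nhdsWithin_le_nhds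
    refine tendsto_nhds_unique h1 (h2.congr' ?_)
    filter_upwards [Ioo_mem_nhdsLT (show (0 : ℝ) < 1 by norm_num)] with y hy
    exact (im_integral_hankelKernel_of_mem_Ioo hφ hc hy.1 hy.2).symm
  have hup : ∀ n : ℕ, ∀ z ∈ Ioc (0 : ℝ) 1,
      (∫ r in Ioi 0, hankelKernel φ c (z + n) r).im = π * (Real.Gamma (z + n))⁻¹ := by
    intro n z hz
    induction n with
    | zero => simpa using hbase z hz
    | succ n ih =>
      have hpos : z + n ≠ 0 := by
        have := hz.1
        positivity
      rw [im_integral_hankelKernel_add_one _ hs hφ' hc, hrec (z + n)] at ih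
      push_cast
      rw [← add_assoc]
      refine mul_left_cancel₀ hpos ?_
      linarith
  have hdown : ∀ n : ℕ, ∀ z ∈ Ioc (0 : ℝ) 1,
      (∫ r in Ioi 0, hankelKernel φ c (z - n) r).im = π * (Real.Gamma (z - n))⁻¹ := by
    intro n z hz
    induction n with
    | zero => simpa using hbase z hz
    | succ n ih =>
      have h1 : z - (n + 1 : ℕ) + 1 = z - n := by push_cast; ring
      rw [im_integral_hankelKernel_add_one _ hs hφ' hc, hrec, h1, ih]
      ring
  have hmem : z - (⌈z⌉ - 1 : ℤ) ∈ Ioc (0 : ℝ) 1 := by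
    push_cast
    exact ⟨by linarith [Int.ceil_lt_add_one z], by linarith [Int.le_ceil z]⟩
  obtain ⟨n, hn | hn⟩ := Int.eq_nat_or_neg (⌈z⌉ - 1)
  · have := hup n _ hmem
    rw [hn] at this
    simpa using this
  · have := hdown n _ hmem
    rw [hn] at this
    simpa using this

theorem hankelKernel_mul_cpow {φ c r : ℝ} (z p : ℝ) (h : hankelRay φ c r ≠ 0) :
    hankelKernel φ c z r * hankelRay φ c r ^ (p : ℂ) = hankelKernel φ c (z - p) r := by
  have : (-((z - p : ℝ) : ℂ)) = -z + p := by push_cast; ring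
  rw [hankelKernel, hankelKernel, this, Complex.cpow_add _ _ h]
  ring

theorem hankelKernel_mul_cpow_pow {φ c r : ℝ} (z p : ℝ) (n : ℕ) (h : hankelRay φ c r ≠ 0) :
    hankelKernel φ c z r * (hankelRay φ c r ^ (p : ℂ)) ^ n =
      hankelKernel φ c (z - n * p) r := by
  rw [← hankelKernel_mul_cpow z (n * p) h, ← Complex.cpow_nat_mul]
  push_cast
  rfl

theorem mainardiM_eq_im_integral {ν φ c : ℝ} (hν0 : 0 < ν) (hν1 : ν < 1)
    (hφ : φ ∈ Ioo (π / 2) π) (hc : 0 < c) (x : ℝ) :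
    mainardiM ν x = π⁻¹ * (∫ r in Ioi 0,
      hankelKernel φ c (1 - ν) r * Complex.exp (-x * hankelRay φ c r ^ (ν : ℂ))).im := by
  have hs : 0 < sin φ := sin_pos_of_pos_of_lt_pi (by linarith [hφ.1, pi_pos]) hφ.2
  have hφ' : cos φ < 0 := cos_neg_of_pi_div_two_lt_of_lt hφ.1 (by linarith [hφ.2, pi_pos])
  set β := c + (c * sin φ)⁻¹ with hβ
  have hβ0 : 0 < β := by positivity
  set B : ℝ → ℝ := fun r => rexp c * (rexp (cos φ * r) * (r + β) ^ (1 : ℝ)) with hB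
  have hexp : ∀ r : ℝ, HasSum (fun n : ℕ => B r * ((|x| * (r + β) ^ ν) ^ n / n.factorial))
      (B r * rexp (|x| * (r + β) ^ ν)) := fun r => by
    rw [Real.exp_eq_exp_ℝ]
    exact (NormedSpace.expSeries_div_hasSum_exp (|x| * (r + β) ^ ν)).mul_left _
  have hsum := hasSum_integral_of_dominated_convergence (μ := volume.restrict (Ioi (0 : ℝ)))
    (F := fun (n : ℕ) r => (((-x) ^ n / n.factorial : ℝ) : ℂ) *
      hankelKernel φ c (-ν * n + (1 - ν)) r)
    (f := fun r => hankelKernel φ c (1 - ν) r * Complex.exp (-x * hankelRay φ c r ^ (ν : ℂ)))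
    (fun n r => B r * ((|x| * (r + β) ^ ν) ^ n / n.factorial))
    (fun n => ((measurable_hankelKernel φ c _).const_mul _).aestronglyMeasurable)
    ?_ (Eventually.of_forall fun r => (hexp r).summable) ?_ ?_
  · have him := Complex.hasSum_im hsum
    rw [mainardiM, wright, ← him.tsum_eq, ← tsum_mul_left]
    congr 1
    ext n
    rw [integral_const_mul, Complex.im_ofReal_mul, im_integral_hankelKernel _ hφ hc]
    have := pi_pos.ne'
    field_simp
  · intro n
    filter_upwards [ae_restrict_mem measurableSet_Ioi] with r hr
    have hr : 0 < r := hr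
    rw [show -ν * n + (1 - ν) = (1 - ν) - n * ν by ring,
      ← hankelKernel_mul_cpow_pow _ _ _ (hankelRay_ne_zero hs hr.le (by linarith)), norm_mul,
      norm_mul, norm_pow, Complex.norm_cpow_real, Complex.norm_real, norm_div, norm_pow, norm_neg,
      Real.norm_eq_abs, Real.norm_natCast, mul_pow]
    have h1 : ‖hankelKernel φ c (1 - ν) r‖ ≤ B r :=
      norm_hankelKernel_le hs hc le_rfl le_rfl hr.le (by rw [abs_of_pos] <;> linarith)
    have h2 : ‖hankelRay φ c r‖ ≤ r + β := by
      have := norm_hankelRay_le (φ := φ) hc.le hr.le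
      have h3 : 0 < (c * sin φ)⁻¹ := by positivity
      linarith
    calc _ ≤ |x| ^ n / n.factorial * (B r * ((r + β) ^ ν) ^ n) := by gcongr
      _ = _ := by ring
  · simp_rw [fun r => (hexp r).tsum_eq]
    have := (integrableOn_exp_mul_rpow_mul_exp_rpow (P := 1) (x := |x|) hφ' hβ0 hν1).const_mul
      (rexp c)
    refine this.congr (Eventually.of_forall fun r => ?_)
    simp only [hB]
    ring
  · filter_upwards [ae_restrict_mem measurableSet_Ioi] with r hr
    have hr : 0 < r := hr
    have h := (NormedSpace.expSeries_div_hasSum_exp (-x * hankelRay φ c r ^ (ν : ℂ))).mul_left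
      (hankelKernel φ c (1 - ν) r)
    rw [← Complex.exp_eq_exp_ℂ] at h
    refine h.congr_fun fun n => ?_
    rw [show -ν * n + (1 - ν) = (1 - ν) - n * ν by ring,
      ← hankelKernel_mul_cpow_pow _ _ _ (hankelRay_ne_zero hs hr.le (by linarith)), mul_pow]
    push_cast
    ring

theorem integral_cos_mul_cexp_neg_mul {w : ℂ} (hw : 0 < w.re) (κ : ℝ) :
    ∫ x in Ioi (0 : ℝ), (cos (κ * x) : ℂ) * Complex.exp (-x * w) = w / (w ^ 2 + κ ^ 2) := by
  have h1 : (-w + κ * Complex.I).re < 0 := by simpa using hw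
  have h2 : (-w - κ * Complex.I).re < 0 := by simpa using hw
  have hpt : ∀ x : ℝ, (cos (κ * x) : ℂ) * Complex.exp (-x * w) =
      (1 / 2) * (Complex.exp ((-w + κ * Complex.I) * x) +
        Complex.exp ((-w - κ * Complex.I) * x)) := by
    intro x
    rw [Complex.ofReal_cos, Complex.cos, show (-w + κ * Complex.I) * x = -x * w +
      (κ * x : ℝ) * Complex.I by push_cast; ring, show (-w - κ * Complex.I) * x = -x * w +
      -(κ * x : ℝ) * Complex.I by push_cast; ring, Complex.exp_add, Complex.exp_add]
    ring
  simp_rw [hpt]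
  rw [integral_const_mul, integral_add (integrableOn_exp_mul_complex_Ioi h1 0)
    (integrableOn_exp_mul_complex_Ioi h2 0), integral_exp_mul_complex_Ioi h1,
    integral_exp_mul_complex_Ioi h2]
  have n1 : -w + κ * Complex.I ≠ 0 := fun h => by simp [h] at h1
  have n2 : -w - κ * Complex.I ≠ 0 := fun h => by simp [h] at h2
  have n3 : w ^ 2 + κ ^ 2 = (-w + κ * Complex.I) * (-w - κ * Complex.I) := by
    linear_combination (κ : ℂ) ^ 2 * Complex.I_sq
  rw [n3]
  simp only [Complex.ofReal_zero, mul_zero, Complex.exp_zero]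
  field_simp
  ring

theorem hasSum_integral_hankelKernel_div {ν φ c κ : ℝ} (hν0 : 0 < ν)
    (hφ : φ ∈ Ioo (π / 2) π) (hc : 0 < c) (hκ : |κ| < (c * sin φ) ^ ν) :
    HasSum (fun n : ℕ => (((-κ ^ 2) ^ n : ℝ) : ℂ) *
        ∫ r in Ioi 0, hankelKernel φ c (2 * ν * n + 1) r)
      (∫ r in Ioi 0, hankelKernel φ c (1 - ν) r * (hankelRay φ c r ^ (ν : ℂ) /
        ((hankelRay φ c r ^ (ν : ℂ)) ^ 2 + κ ^ 2))) := by
  have hs : 0 < sin φ := sin_pos_of_pos_of_lt_pi (by linarith [hφ.1, pi_pos]) hφ.2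
  have hφ' : cos φ < 0 := cos_neg_of_pi_div_two_lt_of_lt hφ.1 (by linarith [hφ.2, pi_pos])
  have hδ : 0 < (c * sin φ) ^ ν := by positivity
  set q := (|κ| / (c * sin φ) ^ ν) ^ 2 with hq
  have hq0 : 0 ≤ q := by positivity
  have hq1 : q < 1 := by
    rw [hq, sq_lt_one_iff₀ (by positivity)]
    exact (div_lt_one hδ).2 hκ
  have hw : ∀ r, ‖-(κ : ℂ) ^ 2 * ((hankelRay φ c r ^ (ν : ℂ)) ^ 2)⁻¹‖ ≤ q := by
    intro r
    rw [norm_mul, norm_neg, norm_pow, Complex.norm_real, norm_inv, norm_pow,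
      Complex.norm_cpow_real, Real.norm_eq_abs, hq, div_pow, div_eq_mul_inv]
    gcongr
    exact le_norm_hankelRay_left
  have hpt : ∀ (n : ℕ), ∀ r ∈ Ioi (0 : ℝ),
      (((-κ ^ 2) ^ n : ℝ) : ℂ) * hankelKernel φ c (2 * ν * n + 1) r =
        hankelKernel φ c 1 r * (-(κ : ℂ) ^ 2 * ((hankelRay φ c r ^ (ν : ℂ)) ^ 2)⁻¹) ^ n := by
    intro n r hr
    have hr : 0 < r := hr
    have hne := hankelRay_ne_zero (c := c) hs hr.le (by linarith)
    have hne' : hankelRay φ c r ^ (ν : ℂ) ≠ 0 := by simp [Complex.cpow_eq_zero_iff, hne]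
    have := hankelKernel_mul_cpow_pow (2 * ν * n + 1) ν (2 * n) hne
    rw [show 2 * ν * n + 1 - (2 * n : ℕ) * ν = 1 by push_cast; ring] at this
    rw [← this, mul_pow, inv_pow, ← pow_mul]
    push_cast
    field_simp
  have hsum := hasSum_integral_of_dominated_convergence (μ := volume.restrict (Ioi (0 : ℝ)))
    (F := fun (n : ℕ) r => (((-κ ^ 2) ^ n : ℝ) : ℂ) * hankelKernel φ c (2 * ν * n + 1) r)
    (f := fun r => hankelKernel φ c (1 - ν) r * (hankelRay φ c r ^ (ν : ℂ) /
        ((hankelRay φ c r ^ (ν : ℂ)) ^ 2 + κ ^ 2)))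
    (fun n r => ‖hankelKernel φ c 1 r‖ * q ^ n)
    (fun n => ((measurable_hankelKernel φ c _).const_mul _).aestronglyMeasurable)
    ?_ (Eventually.of_forall fun r => (summable_geometric_of_lt_one hq0 hq1).mul_left _) ?_ ?_
  · simpa only [integral_const_mul] using hsum
  · intro n
    filter_upwards [ae_restrict_mem measurableSet_Ioi] with r hr
    rw [hpt n r hr, norm_mul, norm_pow]
    gcongr
    exact hw r
  · simp_rw [tsum_mul_left]
    exact (integrableOn_hankelKernel 1 hs hφ' hc).norm.mul_const _
  · filter_upwards [ae_restrict_mem measurableSet_Ioi] with r hr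
    have hr' : 0 < r := hr
    have hne := hankelRay_ne_zero (c := c) hs hr'.le (by linarith)
    have hne' : hankelRay φ c r ^ (ν : ℂ) ≠ 0 := by simp [Complex.cpow_eq_zero_iff, hne]
    have h := (hasSum_geometric_of_norm_lt_one ((hw r).trans_lt hq1)).mul_left
      (hankelKernel φ c 1 r)
    simp_rw [← hpt _ r hr] at h
    convert! h using 1
    rw [← hankelKernel_mul_cpow 1 ν hne]
    have h1 : 1 - -(κ : ℂ) ^ 2 * ((hankelRay φ c r ^ (ν : ℂ)) ^ 2)⁻¹ =
        ((hankelRay φ c r ^ (ν : ℂ)) ^ 2 + κ ^ 2) / (hankelRay φ c r ^ (ν : ℂ)) ^ 2 := by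
      field_simp
      ring
    rw [h1, inv_div]
    ring

theorem le_re_hankelRay_cpow {ν φ c r : ℝ} (hν0 : 0 < ν) (hφ : φ ∈ Ioo 0 π) (hνφ : ν * φ < π / 2)
    (hc : 0 < c) (hr : 0 ≤ r) :
    (c * sin φ) ^ ν * cos (ν * φ) ≤ (hankelRay φ c r ^ (ν : ℂ)).re := by
  have hs := sin_pos_of_mem_Ioo hφ
  have harg := arg_hankelRay_mem hφ hc hr
  have h0 : 0 < cos (ν * φ) :=
    cos_pos_of_mem_Ioo ⟨by linarith [mul_pos hν0 hφ.1, pi_pos], hνφ⟩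
  rw [Complex.cpow_ofReal_re]
  have h1 : cos (ν * φ) ≤ cos ((hankelRay φ c r).arg * ν) := by
    rw [mul_comm _ ν]
    refine cos_le_cos_of_nonneg_of_le_pi (mul_nonneg hν0.le harg.1) (by linarith [pi_pos]) ?_
    exact mul_le_mul_of_nonneg_left harg.2 hν0.le
  gcongr
  exact le_norm_hankelRay_left

theorem integrable_prod_cos_mul_hankelKernel {ν φ c : ℝ} (κ : ℝ) (hν0 : 0 < ν)
    (hφ : φ ∈ Ioo (π / 2) π) (hνφ : ν * φ < π / 2) (hc : 0 < c) :
    Integrable (Function.uncurry fun x r : ℝ => (cos (κ * x) : ℂ) *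
        (hankelKernel φ c (1 - ν) r * Complex.exp (-x * hankelRay φ c r ^ (ν : ℂ))))
      ((volume.restrict (Ioi 0)).prod (volume.restrict (Ioi 0))) := by
  have hφ0 : φ ∈ Ioo 0 π := ⟨by linarith [hφ.1, pi_pos], hφ.2⟩
  have hs : 0 < sin φ := sin_pos_of_mem_Ioo hφ0
  have hφ' : cos φ < 0 := cos_neg_of_pi_div_two_lt_of_lt hφ.1 (by linarith [hφ.2, pi_pos])
  set A := (c * sin φ) ^ ν * cos (ν * φ) with hA
  have hA0 : 0 < A := mul_pos (by positivity)
    (cos_pos_of_mem_Ioo ⟨by linarith [mul_pos hν0 hφ0.1, pi_pos], hνφ⟩)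
  have hx : Integrable (fun x => rexp (-A * x)) (volume.restrict (Ioi 0)) :=
    integrableOn_exp_mul_Ioi (by linarith) 0
  refine (hx.mul_prod (integrableOn_hankelKernel (1 - ν) hs hφ' hc).norm).mono' ?_ ?_
  · have h1 := measurable_hankelRay φ c
    have h2 := measurable_hankelKernel φ c (1 - ν)
    apply Measurable.aestronglyMeasurable
    unfold Function.uncurry
    fun_prop
  · rw [Measure.prod_restrict]
    filter_upwards [ae_restrict_mem (measurableSet_Ioi.prod measurableSet_Ioi)] with ⟨x, r⟩ hxr
    have hx : 0 < x := hxr.1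
    have hr : 0 < r := hxr.2
    have hre := le_re_hankelRay_cpow hν0 hφ0 hνφ hc hr.le
    simp only [Function.uncurry]
    rw [norm_mul, norm_mul, Complex.norm_real, Complex.norm_exp, Real.norm_eq_abs]
    have h1 : (-(x : ℂ) * hankelRay φ c r ^ (ν : ℂ)).re ≤ -A * x := by
      rw [← Complex.ofReal_neg, Complex.re_ofReal_mul]
      nlinarith
    calc _ ≤ 1 * (‖hankelKernel φ c (1 - ν) r‖ * rexp (-A * x)) := by
          gcongr; exact abs_cos_le_one _
      _ = _ := by ring

theorem exists_hankel_angle {ν : ℝ} (hν0 : 0 < ν) (hν1 : ν < 1) :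
    ∃ φ ∈ Ioo (π / 2) π, ν * φ < π / 2 := by
  refine ⟨π / (1 + ν), ⟨?_, ?_⟩, ?_⟩
  · exact div_lt_div_of_pos_left pi_pos (by linarith) (by linarith)
  · exact div_lt_self pi_pos (by linarith)
  · rw [← mul_div_assoc, div_lt_div_iff₀ (by linarith) two_pos]
    nlinarith [pi_pos]

theorem integrableOn_mainardiM {ν : ℝ} (hν0 : 0 < ν) (hν1 : ν < 1) :
    IntegrableOn (mainardiM ν) (Ioi 0) := by
  obtain ⟨φ, hφ, hνφ⟩ := exists_hankel_angle hν0 hν1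
  have h := ((integrable_prod_cos_mul_hankelKernel (c := 1) 0 hν0 hφ hνφ
    one_pos).integral_prod_left.im).const_mul π⁻¹
  refine h.congr (Eventually.of_forall fun x => ?_)
  simp [mainardiM_eq_im_integral hν0 hν1 hφ one_pos, Function.uncurry]

theorem integral_cos_mul_mainardiM {ν : ℝ} (hν0 : 0 < ν) (hν1 : ν < 1) (κ : ℝ) :
    ∫ x in Ioi (0 : ℝ), cos (κ * x) * mainardiM ν x = mittagLeffler (2 * ν) 1 (-κ ^ 2) := by
  obtain ⟨φ, hφ, hνφ⟩ := exists_hankel_angle hν0 hν1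
  have hφ0 : φ ∈ Ioo 0 π := ⟨by linarith [hφ.1, pi_pos], hφ.2⟩
  have hs : 0 < sin φ := sin_pos_of_mem_Ioo hφ0
  obtain ⟨c, hc, hκ⟩ : ∃ c : ℝ, 0 < c ∧ |κ| < (c * sin φ) ^ ν := by
    refine ⟨(|κ| + 1) ^ ν⁻¹ / sin φ, by positivity, ?_⟩
    rw [div_mul_cancel₀ _ hs.ne', Real.rpow_inv_rpow (by positivity) hν0.ne']
    linarith
  have hint := integrable_prod_cos_mul_hankelKernel κ hν0 hφ hνφ hc
  have hM : ∀ x : ℝ, cos (κ * x) * mainardiM ν x = π⁻¹ * (∫ r in Ioi 0, (cos (κ * x) : ℂ) *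
      (hankelKernel φ c (1 - ν) r * Complex.exp (-x * hankelRay φ c r ^ (ν : ℂ)))).im := by
    intro x
    rw [mainardiM_eq_im_integral hν0 hν1 hφ hc, integral_const_mul, Complex.im_ofReal_mul]
    ring
  have him : ∀ {f : ℝ → ℂ}, IntegrableOn f (Ioi 0) →
      ∫ x in Ioi 0, (f x).im = (∫ x in Ioi 0, f x).im := fun hf =>
    Complex.imCLM.integral_comp_comm hf
  simp_rw [hM]
  have hleft := hint.integral_prod_left
  simp only [Function.uncurry] at hleft
  rw [integral_const_mul, him hleft, integral_integral_swap hint]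
  have hinner : ∀ r ∈ Ioi (0 : ℝ), ∫ x in Ioi (0 : ℝ), (cos (κ * x) : ℂ) *
      (hankelKernel φ c (1 - ν) r * Complex.exp (-x * hankelRay φ c r ^ (ν : ℂ))) =
      hankelKernel φ c (1 - ν) r * (hankelRay φ c r ^ (ν : ℂ) /
        ((hankelRay φ c r ^ (ν : ℂ)) ^ 2 + κ ^ 2)) := by
    intro r hr
    have hre : 0 < (hankelRay φ c r ^ (ν : ℂ)).re :=
      (mul_pos (by positivity) (cos_pos_of_mem_Ioo
        ⟨by linarith [mul_pos hν0 hφ0.1, pi_pos], hνφ⟩)).trans_le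
        (le_re_hankelRay_cpow hν0 hφ0 hνφ hc (le_of_lt hr))
    simp_rw [mul_left_comm _ (hankelKernel φ c (1 - ν) r)]
    rw [integral_const_mul, integral_cos_mul_cexp_neg_mul hre]
  rw [setIntegral_congr_fun measurableSet_Ioi hinner,
    ← (Complex.hasSum_im (hasSum_integral_hankelKernel_div hν0 hφ hc hκ)).tsum_eq,
    mittagLeffler, ← tsum_mul_left]
  congr 1
  ext n
  rw [Complex.im_ofReal_mul, im_integral_hankelKernel _ hφ hc]
  have := pi_pos.ne'
  field_simp

theorem integral_cexp_mul_comp_abs {f : ℝ → ℝ} (hf : IntegrableOn f (Ioi 0)) (κ : ℝ) :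
    ∫ x : ℝ, Complex.exp (Complex.I * κ * x) * (f |x| : ℂ) =
      ((2 * ∫ x in Ioi (0 : ℝ), cos (κ * x) * f x : ℝ) : ℂ) := by
  have hI : IntegrableOn (fun x => f |x|) (Ioi 0) :=
    hf.congr_fun (fun x hx => by rw [abs_of_pos hx]) measurableSet_Ioi
  have hIic : IntegrableOn (fun x => f |x|) (Iic 0) := by
    have hneg : MeasurableEmbedding fun x : ℝ => -x := (Homeomorph.neg ℝ).measurableEmbedding
    rw [← Measure.map_neg_eq_self (volume : Measure ℝ), hneg.integrableOn_map_iff]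
    simpa [Function.comp_def, integrableOn_Ici_iff_integrableOn_Ioi] using hI
  have hfa : Integrable (fun x : ℝ => f |x|) := by
    rw [← integrableOn_univ, ← Iic_union_Ioi (a := (0 : ℝ))]
    exact hIic.union hI
  have hcos : Integrable fun x : ℝ => cos (κ * x) * f |x| :=
    hfa.bdd_mul (c := 1) (by fun_prop) (Eventually.of_forall fun x => abs_cos_le_one _)
  have hsin : Integrable fun x : ℝ => sin (κ * x) * f |x| :=
    hfa.bdd_mul (c := 1) (by fun_prop) (Eventually.of_forall fun x => abs_sin_le_one _)
  have hodd : ∫ x : ℝ, sin (κ * x) * f |x| = 0 := by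
    have h := integral_neg_eq_self (fun x : ℝ => sin (κ * x) * f |x|) volume
    simp only [mul_neg, sin_neg, abs_neg, neg_mul, integral_neg] at h
    linarith
  have heven : ∫ x : ℝ, cos (κ * x) * f |x| = 2 * ∫ x in Ioi (0 : ℝ), cos (κ * x) * f x := by
    rw [← integral_comp_abs (f := fun x => cos (κ * x) * f x)]
    congr 1
    ext x
    rcases abs_choice x with h | h <;> simp [h]
  have hpt : ∀ x : ℝ, Complex.exp (Complex.I * κ * x) * (f |x| : ℂ) =
      ((cos (κ * x) * f |x| : ℝ) : ℂ) + ((sin (κ * x) * f |x| : ℝ) : ℂ) * Complex.I := by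
    intro x
    rw [show Complex.I * κ * x = ((κ * x : ℝ) : ℂ) * Complex.I by push_cast; ring,
      Complex.exp_mul_I]
    push_cast
    ring
  simp_rw [hpt]
  rw [integral_add hcos.ofReal (hsin.ofReal.mul_const _), integral_mul_const,
    integral_complex_ofReal, integral_complex_ofReal, hodd, heven]
  simp

theorem characteristic_function_mainardiM (ν : ℝ) (hν0 : 0 < ν) (hν1 : ν < 1)
    (κ : ℝ) :
    (∫ x in Set.Ioi (0 : ℝ), Real.cos (κ * x) * mainardiM ν x =
      mittagLeffler (2 * ν) 1 (-κ ^ 2)) ∧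
    ∫ x : ℝ, Complex.exp (Complex.I * κ * x) * ((1 / 2) * mainardiM ν |x| : ℝ) =
      (mittagLeffler (2 * ν) 1 (-κ ^ 2) : ℂ) := by
  have h := integral_cos_mul_mainardiM hν0 hν1 κ
  refine ⟨h, ?_⟩
  rw [integral_cexp_mul_comp_abs (f := fun x => 1 / 2 * mainardiM ν x)
    ((integrableOn_mainardiM hν0 hν1).const_mul _)]
  simp_rw [mul_left_comm _ (1 / 2 : ℝ)]
  rw [integral_const_mul, h]
  congr 1
  ring
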